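/- arXiv:2110.13019 — 2 statements merged into one kernel-verified Lean document; each statement's English description precedes it below -/
import Mathlib

section
/- Let W and W̃ be N×N discrete matrix weights and let Φ(x) = K_2x² + K_1x + K_0 and Ψ(x) = J_1x + J_0 be matrix polynomials such that W̃(x) = W(x)Φ(x) and W̃(x) − W̃(x−1) = W(x)Ψ(x) for all x ∈ ℤ. Let (P_n) and (P̃_n) be the monic orthogonal sequences of W and W̃. Then the operator S = −Φ(x)^* + η^{−1}(Φ(x)^* − Ψ(x)^*) acts as a forward shift: for every n ≥ 1, −P̃_{n−1}(x)Φ(x)^* + P̃_{n−1}(x−1)(Φ(x)^* − Ψ(x)^*) = G_n·P_n(x) as an identity of matrix polynomials in x, where G_n = −(n−1)K_2^* − J_1^*. -/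
open scoped BigOperators ComplexOrder
open Matrix Polynomial Filter

noncomputable section

/-- The space of `N × N` complex matrices. -/
abbrev Mat (N : ℕ) := Matrix (Fin N) (Fin N) ℂ

/-- Evaluation of a matrix polynomial at a (scalar) complex number. -/
def matEval {N : ℕ} (P : Polynomial (Mat N)) (z : ℂ) : Mat N :=
  P.eval (z • (1 : Mat N))

/-- Matrix-valued inner product associated to a discrete matrix weight:
`⟨P,Q⟩_W = ∑_{x=0}^∞ P(x) W(x) Q(x)^*`. -/
def innerW {N : ℕ} (W : ℤ → Mat N) (P Q : Polynomial (Mat N)) : Mat N :=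
  ∑' x : ℕ, matEval P x * W x * (matEval Q x)ᴴ

/-- `W : ℤ → M_N(ℂ)` is an `N × N` discrete matrix weight: positive definite on ℕ,
zero on negative integers, with entrywise absolutely convergent moments of all orders. -/
structure IsWeight {N : ℕ} (W : ℤ → Mat N) : Prop where
  posDef : ∀ x : ℕ, (W (x : ℤ)).PosDef
  neg : ∀ x : ℤ, x < 0 → W x = 0
  moments : ∀ k : ℕ, ∀ i j : Fin N, Summable fun x : ℕ => (x : ℝ) ^ k * ‖W (x : ℤ) i j‖

/-- `P` is the monic orthogonal sequence of the discrete matrix weight `W`. -/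
structure IsMOS {N : ℕ} (W : ℤ → Mat N) (P : ℕ → Polynomial (Mat N)) : Prop where
  monic : ∀ n, (P n).Monic
  deg : ∀ n, (P n).natDegree = n
  orth : ∀ m n, m ≠ n → innerW W (P m) (P n) = 0

/-- Left evaluation `Q⟦M⟧ = ∑_k M^k * A_k` of a matrix polynomial at a matrix. -/
def leftEval {N : ℕ} (Q : Polynomial (Mat N)) (M : Mat N) : Mat N :=
  Q.sum fun k a => M ^ k * a

/-- The block Vandermonde condition for an eigenvalue function `ρ`. -/
def BlockVdm {N : ℕ} (ρ : ℕ → Mat N) : Prop :=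
  ∀ x : ℕ, ∃ k : Fin (x + 1) → ℕ,
    IsUnit (Matrix.of fun p q : Fin (x + 1) × Fin N => (ρ (k p.1) ^ (q.1 : ℕ)) p.2 q.2)

/-- The backward difference operator `(G·∇)(x) = G(x) - G(x-1)`. -/
def nabla {N : ℕ} (G : ℤ → Mat N) : ℤ → Mat N := fun x => G x - G (x - 1)

section

variable {N : ℕ}

/-- Evaluation at a central scalar matrix, as a ring homomorphism. -/
def matEvalHom (z : ℂ) : Polynomial (Mat N) →+* Mat N :=
  Polynomial.eval₂RingHom' (RingHom.id _) (z • (1 : Mat N)) fun a => by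
    simp [commute_iff_eq]

lemma matEval_eq_matEvalHom (P : Polynomial (Mat N)) (z : ℂ) : matEval P z = matEvalHom z P :=
  rfl

lemma matEvalHom_C (z : ℂ) (A : Mat N) : matEvalHom z (C A) = A := by
  simp [matEvalHom]

lemma matEvalHom_X (z : ℂ) : matEvalHom z (X : Polynomial (Mat N)) = z • (1 : Mat N) := by
  simp [matEvalHom]

lemma matEvalHom_C_mul_X_pow (z : ℂ) (A : Mat N) (k : ℕ) :
    matEvalHom z (C A * X ^ k) = z ^ k • A := by
  rw [map_mul, map_pow, matEvalHom_C, matEvalHom_X, _root_.smul_pow, one_pow, Algebra.mul_smul_comm,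
    mul_one]

lemma matEvalHom_taylor (z c : ℂ) (P : Polynomial (Mat N)) :
    matEvalHom z (taylor (c • (1 : Mat N)) P) = matEvalHom (z + c) P := by
  induction P using Polynomial.induction_on' with
  | add p q hp hq => simp only [map_add, hp, hq]
  | monomial k A =>
    rw [taylor_monomial, ← C_mul_X_pow_eq_monomial]
    simp only [map_mul, map_pow, map_add, matEvalHom_C, matEvalHom_X, add_smul]

/-- A matrix polynomial vanishing on the natural numbers is zero. -/
lemma eq_zero_of_matEvalHom_natCast_eq_zero {T : Polynomial (Mat N)}
    (h : ∀ x : ℕ, matEvalHom (x : ℂ) T = 0) : T = 0 := by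
  have entry : ∀ (i j : Fin N) (z : ℂ), matEvalHom z T i j =
      (∑ k ∈ T.support, Polynomial.monomial k (T.coeff k i j)).eval z := by
    intro i j z
    conv_lhs => rw [T.as_sum_support_C_mul_X_pow, map_sum]
    simp only [matEvalHom_C_mul_X_pow, Matrix.sum_apply, Matrix.smul_apply, smul_eq_mul,
      Polynomial.eval_finsetSum, Polynomial.eval_monomial, mul_comm]
  ext k i j
  have hz : (∑ k ∈ T.support, Polynomial.monomial k (T.coeff k i j)) = 0 := by
    refine Polynomial.eq_zero_of_infinite_isRoot _
      ((Set.infinite_range_of_injective (Nat.cast_injective (R := ℂ))).mono ?_)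
    rintro _ ⟨x, rfl⟩
    change Polynomial.eval _ _ = 0
    rw [← entry, h, Matrix.zero_apply]
  have hk := congrArg (fun p => p.coeff k) hz
  simp only [Polynomial.finsetSum_coeff, Polynomial.coeff_monomial, Finset.sum_ite_eq',
    Polynomial.mem_support_iff, Polynomial.coeff_zero] at hk
  by_cases h0 : T.coeff k = 0
  · simp [h0]
  · simpa [h0] using hk

section InnerProduct

variable {W : ℤ → Mat N}

lemma IsWeight.summable_innerW (hW : IsWeight W) (P Q : Polynomial (Mat N)) :
    Summable fun x : ℕ => matEvalHom (x : ℂ) P * W x * (matEvalHom (x : ℂ) Q)ᴴ := by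
  induction P using Polynomial.induction_on' with
  | add p q hp hq =>
    simpa only [map_add, add_mul] using hp.add hq
  | monomial k A =>
    induction Q using Polynomial.induction_on' with
    | add p q hp hq =>
      simpa only [map_add, conjTranspose_add, mul_add] using hp.add hq
    | monomial l B =>
      have h : Summable fun x : ℕ => ((x : ℂ) ^ (k + l)) • W (x : ℤ) := by
        refine Pi.summable.2 fun i => Pi.summable.2 fun j => ?_
        refine Summable.of_norm ?_
        simpa using hW.moments (k + l) i j
      refine ((h.mul_left A).mul_right Bᴴ).congr fun x => ?_
      simp only [← C_mul_X_pow_eq_monomial, matEvalHom_C_mul_X_pow, conjTranspose_smul, star_pow,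
        Algebra.smul_mul_assoc, Algebra.mul_smul_comm, smul_smul, pow_add]
      simp [mul_comm]

lemma innerW_sub_right (hW : IsWeight W) (P Q R : Polynomial (Mat N)) :
    innerW W P (Q - R) = innerW W P Q - innerW W P R := by
  simp only [innerW, matEval_eq_matEvalHom]
  rw [← (hW.summable_innerW P Q).tsum_sub (hW.summable_innerW P R)]
  simp only [map_sub, conjTranspose_sub, mul_sub]

lemma innerW_sub_left (hW : IsWeight W) (P Q R : Polynomial (Mat N)) :
    innerW W (P - Q) R = innerW W P R - innerW W Q R := by
  simp only [innerW, matEval_eq_matEvalHom]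
  rw [← (hW.summable_innerW P R).tsum_sub (hW.summable_innerW Q R)]
  simp only [map_sub, sub_mul]

lemma innerW_C_mul_right (hW : IsWeight W) (P Q : Polynomial (Mat N)) (A : Mat N) :
    innerW W P (C A * Q) = innerW W P Q * Aᴴ := by
  simp only [innerW, matEval_eq_matEvalHom]
  rw [← (hW.summable_innerW P Q).tsum_mul_right]
  simp only [map_mul, matEvalHom_C, conjTranspose_mul, mul_assoc]

lemma innerW_C_mul_left (hW : IsWeight W) (P Q : Polynomial (Mat N)) (A : Mat N) :
    innerW W (C A * P) Q = A * innerW W P Q := by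
  simp only [innerW, matEval_eq_matEvalHom]
  rw [← (hW.summable_innerW P Q).tsum_mul_left]
  simp only [map_mul, matEvalHom_C, mul_assoc]

lemma eq_zero_of_innerW_self_eq_zero (hW : IsWeight W) {T : Polynomial (Mat N)}
    (h : innerW W T T = 0) : T = 0 := by
  refine eq_zero_of_matEvalHom_natCast_eq_zero fun x => ?_
  ext i j
  let v : ℕ → Fin N → ℂ := fun x => star ((matEvalHom (x : ℂ) T).row i)
  let f : ℕ → ℂ := fun x => star (v x) ⬝ᵥ (W x *ᵥ v x)
  have hs : HasSum f 0 := by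
    have h1 := (hW.summable_innerW T T).hasSum
    change HasSum _ (innerW W T T) at h1
    rw [h] at h1
    have h2 : HasSum _ (0 : ℂ) := Pi.hasSum.1 (Pi.hasSum.1 h1 i) i
    convert h2 using 1
    funext x
    simp only [f, v, star_star]
    rw [mul_assoc, Matrix.mul_apply]
    rfl
  have hnn : 0 ≤ f := fun x => (hW.posDef x).posSemidef.dotProduct_mulVec_nonneg _
  have hx : f x = 0 := congrFun ((hasSum_zero_iff_of_nonneg hnn).1 hs) x
  have hv : v x = 0 := by
    by_contra hne
    exact ((hW.posDef x).dotProduct_mulVec_pos hne).ne' hx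
  exact congrFun (star_eq_zero.1 hv) j

lemma IsMOS.innerW_eq_zero_of_degree_lt (hW : IsWeight W) {P : ℕ → Polynomial (Mat N)}
    (hP : IsMOS W P) (n : ℕ) {R : Polynomial (Mat N)} (hR : R.degree < n) :
    innerW W (P n) R = 0 := by
  suffices H : ∀ d ≤ n, ∀ R : Polynomial (Mat N), R.degree < d → innerW W (P n) R = 0 from
    H n le_rfl R hR
  intro d
  induction d with
  | zero =>
    intro _ R hR
    rw [degree_lt_iff_coeff_zero] at hR
    have : R = 0 := by ext1 k; simpa using hR k k.zero_le
    simp [this, innerW, matEval_eq_matEvalHom]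
  | succ d ih =>
    intro hd R hR
    rw [degree_lt_iff_coeff_zero] at hR
    have hlow : (R - C (R.coeff d) * P d).degree < d := by
      rw [degree_lt_iff_coeff_zero]
      intro k hk
      rw [coeff_sub, coeff_C_mul]
      rcases hk.eq_or_lt with rfl | hk
      · have := (hP.monic d).coeff_natDegree
        rw [hP.deg] at this
        rw [this, mul_one, sub_self]
      · rw [hR k hk, (P d).coeff_eq_zero_of_natDegree_lt (by rwa [hP.deg]), mul_zero, sub_zero]
    have h0 := ih (by omega) _ hlow
    rwa [innerW_sub_right hW, innerW_C_mul_right hW, hP.orth n d (by omega), zero_mul,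
      sub_zero] at h0

/-- Summation by parts: if `S(x) W(x) = -∇(P W̃)(x)` then `⟨S, R⟩_W = ⟨P, ΔR⟩_W̃`. -/
lemma innerW_eq_innerW_taylor_sub {Wt : ℤ → Mat N} (hWt : IsWeight Wt)
    {S P : Polynomial (Mat N)}
    (hS : ∀ x : ℕ, matEvalHom (x : ℂ) S * W x =
      matEvalHom ((x : ℂ) - 1) P * Wt ((x : ℤ) - 1) - matEvalHom (x : ℂ) P * Wt x)
    (R : Polynomial (Mat N)) :
    innerW W S R = innerW Wt P (taylor ((1 : ℂ) • (1 : Mat N)) R - R) := by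
  rw [innerW_sub_right hWt]
  simp only [innerW, matEval_eq_matEvalHom, hS, sub_mul, matEvalHom_taylor]
  set g : ℕ → Mat N := fun x =>
    matEvalHom ((x : ℂ) - 1) P * Wt ((x : ℤ) - 1) * (matEvalHom (x : ℂ) R)ᴴ with hg
  have hg1 : ∀ x : ℕ, g (x + 1) =
      matEvalHom (x : ℂ) P * Wt x * (matEvalHom ((x : ℂ) + 1) R)ᴴ := fun x => by
    simp [hg]
  have hsg1 : Summable fun x => g (x + 1) := by
    have := hWt.summable_innerW P (taylor ((1 : ℂ) • (1 : Mat N)) R)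
    simp only [matEvalHom_taylor] at this
    exact this.congr fun x => (hg1 x).symm
  have hsg : Summable g := (summable_nat_add_iff 1).1 hsg1
  have h0 : g 0 = 0 := by
    simp [hg, hWt.neg (-1) (by norm_num)]
  rw [hsg.tsum_sub (hWt.summable_innerW P R), hsg.tsum_eq_zero_add, h0, zero_add]
  simp only [hg1]

end InnerProduct

lemma taylor_coeff_of_natDegree_le {R : Type*} [Ring R] (r : R) {f : Polynomial R} {m : ℕ}
    (hf : f.natDegree ≤ m + 1) :
    (taylor r f).coeff m = f.coeff m + (m + 1 : ℕ) * f.coeff (m + 1) * r := by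
  have hd : (hasseDeriv m f).natDegree < 2 := by
    have := natDegree_hasseDeriv_le f m
    omega
  rw [taylor_coeff, eval_eq_sum_range' hd]
  simp [Finset.sum_range_succ, hasseDeriv_coeff, Nat.add_comm 1 m]

lemma degree_taylor_sub_self_lt {R : Type*} [Ring R] (r : R) {f : Polynomial R} {m : ℕ}
    (hf : f.degree < (m + 1 : ℕ)) : (taylor r f - f).degree < m := by
  rw [degree_lt_iff_coeff_zero] at hf ⊢
  have hf' : f.natDegree ≤ m := natDegree_le_iff_coeff_eq_zero.2 fun k hk => hf k hk
  intro k hk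
  rw [coeff_sub, taylor_coeff_of_natDegree_le r (by omega), hf (k + 1) (by omega)]
  simp

lemma coeff_mul_C_mul_X_pow_add {R : Type*} [Semiring R] (f : Polynomial R) (a : R) (d i : ℕ) :
    (f * (C a * X ^ i)).coeff (d + i) = f.coeff d * a := by
  rw [← mul_assoc, coeff_mul_X_pow, coeff_mul_C]

/-- Top coefficients of the forward shift operator applied to a monic polynomial of degree `m`. -/
lemma coeff_neg_mul_add_taylor_mul {R : Type*} [Ring R] {A : Polynomial R} {m : ℕ}
    (hA : A.Monic) (hdeg : A.natDegree = m) (a b c d e : R) (j : ℕ) :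
    (-(A * (C a * X ^ 2 + C b * X ^ 1 + C c * X ^ 0)) + taylor (-1) A *
      ((C a * X ^ 2 + C b * X ^ 1 + C c * X ^ 0) - (C d * X ^ 1 + C e * X ^ 0))).coeff (m + 1 + j)
      = if j = 0 then -(m * a) - d else 0 := by
  set B := taylor (-1) A with hB
  have hBm : B.coeff m = 1 := by
    rw [hB, ← hdeg, coeff_taylor_natDegree, hA.leadingCoeff]
  have hBlt : ∀ k, m < k → B.coeff k = 0 := fun k hk =>
    coeff_eq_zero_of_natDegree_lt (by rwa [hB, natDegree_taylor, hdeg])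
  have hD : ∀ k, m ≤ k → (B - A).coeff k = 0 := by
    rw [← degree_lt_iff_coeff_zero]
    refine degree_taylor_sub_self_lt _ (degree_le_natDegree.trans_lt ?_)
    exact_mod_cast hdeg.trans_lt m.lt_succ_self
  have h2 : ((B - A) * (C a * X ^ 2)).coeff (m + 1 + j) = if j = 0 then -(m * a) else 0 := by
    rcases j with _ | j
    · rcases m with _ | m
      · have : B - A = 0 := by ext1 k; simpa using hD k k.zero_le
        simp [this]
      · have hAm : A.coeff (m + 1) = 1 := by
          rw [← hdeg]; exact hA.coeff_natDegree
        rw [coeff_mul_C_mul_X_pow_add _ _ m 2, coeff_sub, hB,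
          taylor_coeff_of_natDegree_le _ hdeg.le, hAm]
        simp only [mul_one, mul_neg, add_sub_cancel_left, neg_mul, if_true]
    · rw [show m + 1 + (j + 1) = (m + j) + 2 by omega, coeff_mul_C_mul_X_pow_add,
        hD _ (by omega)]
      simp
  have h1 : ∀ (f : Polynomial R) (r : R),
      (f * (C r * X ^ 1)).coeff (m + 1 + j) = f.coeff (m + j) * r := fun f r => by
    rw [Nat.add_right_comm, coeff_mul_C_mul_X_pow_add]
  have h0 : ∀ (f : Polynomial R) (r : R),
      (f * (C r * X ^ 0)).coeff (m + 1 + j) = f.coeff (m + 1 + j) * r := fun f r =>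
    coeff_mul_C_mul_X_pow_add f r (m + 1 + j) 0
  have key : ∀ u v w s t : Polynomial R, -(A * (u + v + w)) + B * ((u + v + w) - (s + t)) =
      (B - A) * u + (B - A) * v + (B - A) * w - B * s - B * t := fun u v w s t => by
    noncomm_ring
  rw [key, coeff_sub, coeff_sub, coeff_add, coeff_add, h2, h1, h0, h1, h0, hD _ (by omega),
    hD _ (by omega), hBlt (m + 1 + j) (by omega)]
  split_ifs with hj
  · simp [hj, hBm]
  · simp [hBlt (m + j) (by omega)]

end

/-- under strong Pearson equations the operator
`S = -Φ(x)^* + η⁻¹(Φ(x)^* - Ψ(x)^*)` is a forward shift operator. -/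
theorem forward_shift_operator {N : ℕ} (W Wt : ℤ → Mat N)
    (hW : IsWeight W) (hWt : IsWeight Wt)
    (K2 K1 K0 J1 J0 : Mat N)
    (h1 : ∀ x : ℤ, Wt x = W x * ((x : ℂ) ^ 2 • K2 + (x : ℂ) • K1 + K0))
    (h2 : ∀ x : ℤ, Wt x - Wt (x - 1) = W x * ((x : ℂ) • J1 + J0))
    (P Pt : ℕ → Polynomial (Mat N)) (hP : IsMOS W P) (hPt : IsMOS Wt Pt) :
    ∀ n : ℕ, 1 ≤ n → ∀ z : ℂ,
      -(matEval (Pt (n - 1)) z * (z ^ 2 • K2ᴴ + z • K1ᴴ + K0ᴴ))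
          + matEval (Pt (n - 1)) (z - 1)
              * ((z ^ 2 • K2ᴴ + z • K1ᴴ + K0ᴴ) - (z • J1ᴴ + J0ᴴ))
        = (-(((n : ℂ) - 1) • K2ᴴ) - J1ᴴ) * matEval (P n) z := by
  intro n hn z
  obtain ⟨m, rfl⟩ : ∃ m, n = m + 1 := ⟨n - 1, by omega⟩
  rw [Nat.add_sub_cancel]
  set Φ : Polynomial (Mat N) := C K2ᴴ * X ^ 2 + C K1ᴴ * X ^ 1 + C K0ᴴ * X ^ 0 with hΦ
  set Ψ : Polynomial (Mat N) := C J1ᴴ * X ^ 1 + C J0ᴴ * X ^ 0 with hΨ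
  set S : Polynomial (Mat N) :=
    -(Pt m * Φ) + taylor ((-1 : ℂ) • (1 : Mat N)) (Pt m) * (Φ - Ψ) with hS
  set G : Mat N := -((((m + 1 : ℕ) : ℂ) - 1) • K2ᴴ) - J1ᴴ with hG
  have hΦe : ∀ w : ℂ, matEvalHom w Φ = w ^ 2 • K2ᴴ + w • K1ᴴ + K0ᴴ := fun w => by
    rw [hΦ, map_add, map_add]
    simp only [matEvalHom_C_mul_X_pow]
    rw [pow_one, pow_zero, one_smul]
  have hΨe : ∀ w : ℂ, matEvalHom w Ψ = w • J1ᴴ + J0ᴴ := fun w => by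
    rw [hΨ, map_add]
    simp only [matEvalHom_C_mul_X_pow]
    rw [pow_one, pow_zero, one_smul]
  have hSe : ∀ w : ℂ, matEvalHom w S = -(matEvalHom w (Pt m) * matEvalHom w Φ)
      + matEvalHom (w - 1) (Pt m) * (matEvalHom w Φ - matEvalHom w Ψ) := fun w => by
    simp only [hS, map_add, map_neg, map_mul, matEvalHom_taylor, sub_eq_add_neg]
  simp only [matEval_eq_matEvalHom, ← hΦe, ← hΨe, ← hSe]
  suffices hT : S - C G * P (m + 1) = 0 by
    rw [sub_eq_zero.1 hT, map_mul, matEvalHom_C]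
  have hherm : ∀ {V : ℤ → Mat N}, IsWeight V → ∀ x : ℤ, (V x)ᴴ = V x := by
    intro V hV x
    rcases lt_or_ge x 0 with hx | hx
    · simp [hV.neg x hx]
    · lift x to ℕ using hx
      exact (hV.posDef x).isHermitian
  have hΦW : ∀ x : ℕ, matEvalHom (x : ℂ) Φ * W x = Wt x := fun x => by
    rw [← hherm hWt, h1, conjTranspose_mul, hherm hW, hΦe]
    simp [conjTranspose_add, conjTranspose_smul]
  have hΨW : ∀ x : ℕ, matEvalHom (x : ℂ) Ψ * W x = Wt x - Wt ((x : ℤ) - 1) := fun x => by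
    rw [← hherm hWt x, ← hherm hWt ((x : ℤ) - 1), ← conjTranspose_sub, h2, conjTranspose_mul,
      hherm hW, hΨe]
    simp [conjTranspose_add, conjTranspose_smul]
  have hSW : ∀ x : ℕ, matEvalHom (x : ℂ) S * W x =
      matEvalHom ((x : ℂ) - 1) (Pt m) * Wt ((x : ℤ) - 1) - matEvalHom (x : ℂ) (Pt m) * Wt x :=
    fun x => by
      rw [hSe, add_mul, neg_mul, mul_assoc, mul_assoc, sub_mul, hΦW, hΨW, sub_sub_cancel]
      abel
  have hdeg : (S - C G * P (m + 1)).degree < (m + 1 : ℕ) := by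
    rw [degree_lt_iff_coeff_zero]
    intro k hk
    obtain ⟨j, rfl⟩ := Nat.exists_eq_add_of_le hk
    rw [coeff_sub, coeff_C_mul, hS, hΦ, hΨ, neg_one_smul,
      coeff_neg_mul_add_taylor_mul (hPt.monic m) (hPt.deg m)]
    rcases j with _ | j
    · have hlead := (hP.monic (m + 1)).coeff_natDegree
      rw [hP.deg] at hlead
      rw [if_pos rfl, add_zero, hlead, mul_one, hG, Nat.cast_succ, add_sub_cancel_right,
        Nat.cast_smul_eq_nsmul, nsmul_eq_mul, sub_self]
    · rw [if_neg (by omega), coeff_eq_zero_of_natDegree_lt (by rw [hP.deg]; omega), mul_zero,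
        sub_zero]
  refine eq_zero_of_innerW_self_eq_zero hW ?_
  set T := S - C G * P (m + 1)
  rw [show innerW W T T = innerW W S T - G * innerW W (P (m + 1)) T by
      rw [← innerW_C_mul_left hW, ← innerW_sub_left hW],
    hP.innerW_eq_zero_of_degree_lt hW _ hdeg, innerW_eq_innerW_taylor_sub hWt hSW,
    hPt.innerW_eq_zero_of_degree_lt hWt m (degree_taylor_sub_self_lt _ hdeg), mul_zero, sub_zero]
end
end

section
/- Let a > 0, let 𝒜 ∈ M_N(ℂ) be invertible, let W(0) be positive definite, and suppose that W(x) = (a^x/x!)·𝒜^x·W(0)·(𝒜^*)^x for x ∈ ℕ₀ (and W(x) = 0 for x < 0) is an N×N discrete matrix weight, with monic orthogonal sequence (P_n) and squared norms H_n. Then the squared norms satisfy the nonlinear recurrence H_n = a²𝒜²H_{n−1}(𝒜^*)² − a²𝒜H_{n−1}𝒜^*H_{n−1}^{−1}𝒜H_{n−1}𝒜^* + a𝒜H_{n−1}𝒜^* + 𝒜H_{n−1}(𝒜^*)^{−1}H_{n−2}^{−1}𝒜^{−1}H_{n−1}𝒜^* for all n ≥ 2, together with H_1 = a²𝒜²H_0(𝒜^*)²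 − a²𝒜H_0𝒜^*H_0^{−1}𝒜H_0𝒜^* + a𝒜H_0𝒜^*. -/
open scoped BigOperators ComplexOrder
open Matrix Polynomial Filter

noncomputable section

theorem natDegree_le_of_degree_lt_succ {R : Type*} [Semiring R] {f : R[X]} {m : ℕ}
    (hf : f.degree < ((m + 1 : ℕ) : WithBot ℕ)) : f.natDegree ≤ m :=
  natDegree_le_iff_coeff_eq_zero.2 fun k hk => (degree_lt_iff_coeff_zero f (m + 1)).1 hf k hk

section Evaluation

variable {N : ℕ}

theorem matEval_add (P Q : Polynomial (Mat N)) (z : ℂ) :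
    matEval (P + Q) z = matEval P z + matEval Q z :=
  eval_add

theorem matEval_C_mul (M : Mat N) (P : Polynomial (Mat N)) (z : ℂ) :
    matEval (C M * P) z = M * matEval P z :=
  eval_C_mul

theorem matEval_X_mul (P : Polynomial (Mat N)) (z : ℂ) :
    matEval (X * P) z = z • matEval P z := by
  rw [matEval, X_mul, eval_mul_X, mul_smul_comm, mul_one, matEval]

theorem matEval_mul_C (P : Polynomial (Mat N)) (M : Mat N) (z : ℂ) :
    matEval (P * C M) z = matEval P z * M :=
  eval₂_mul_C' (RingHom.id (Mat N)) (z • 1) ((Commute.one_right M).smul_right z)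

theorem matEval_monomial (k : ℕ) (M : Mat N) (z : ℂ) :
    matEval (monomial k M) z = z ^ k • M := by
  simp [matEval, eval_monomial, _root_.smul_pow]

theorem matEval_taylor (r z : ℂ) (P : Polynomial (Mat N)) :
    matEval (taylor (r • (1 : Mat N)) P) z = matEval P (z + r) := by
  induction P using Polynomial.induction_on' with
  | add p q hp hq => rw [map_add, matEval_add, matEval_add, hp, hq]
  | monomial k c =>
    have key : matEval ((X + C (r • (1 : Mat N))) ^ k) z = (z + r) ^ k • (1 : Mat N) := by
      induction k with
      | zero => simp [matEval]
      | succ k ih =>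
        rw [pow_succ, mul_add, matEval_add, matEval_mul_C, ← X_mul, matEval_X_mul, ih, pow_succ]
        rw [mul_smul_comm, mul_one, smul_smul, smul_smul, ← add_smul]
        ring_nf
    rw [taylor_monomial, matEval_C_mul, key, matEval_monomial, mul_smul_comm, mul_one]

end Evaluation

/-- The second-highest coefficient of a unit translate. -/
theorem coeff_taylor_one_of_natDegree_le {R : Type*} [Semiring R] {f : R[X]} {m : ℕ}
    (hf : f.natDegree ≤ m + 1) :
    (taylor 1 f).coeff m = f.coeff m + (m + 1) * f.coeff (m + 1) := by
  have hdeg : (hasseDeriv m f).natDegree < 2 :=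
    (natDegree_hasseDeriv_le f m).trans_lt (by omega)
  rw [taylor_coeff, eval_eq_sum_range' hdeg]
  simp [Finset.sum_range_succ, hasseDeriv_coeff, add_comm 1 m]

theorem coeff_taylor_of_natDegree_le {R : Type*} [Semiring R] {f : R[X]} {m : ℕ} (r : R)
    (hf : f.natDegree ≤ m) : (taylor r f).coeff m = f.coeff m := by
  rcases hf.lt_or_eq with h | rfl
  · rw [coeff_eq_zero_of_natDegree_lt h,
      coeff_eq_zero_of_natDegree_lt ((natDegree_taylor f r).trans_lt h)]
  · exact coeff_taylor_natDegree r f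

namespace IsWeight

variable {N : ℕ} {W : ℤ → Mat N}

theorem isHermitian (hW : IsWeight W) (x : ℕ) : (W x)ᴴ = W x :=
  (hW.posDef x).isHermitian

theorem summable_pow_smul (hW : IsWeight W) (k : ℕ) :
    Summable fun x : ℕ => (x : ℂ) ^ k • W x := by
  refine Pi.summable.2 fun i => Pi.summable.2 fun j => ?_
  refine Summable.of_norm ?_
  simpa using hW.moments k i j

theorem summable (hW : IsWeight W) (P Q : Polynomial (Mat N)) :
    Summable fun x : ℕ => matEval P x * W x * (matEval Q x)ᴴ := by
  induction P using Polynomial.induction_on' with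
  | add p q hp hq => simpa only [matEval_add, add_mul] using hp.add hq
  | monomial k c =>
    induction Q using Polynomial.induction_on' with
    | add p q hp hq => simpa only [matEval_add, conjTranspose_add, mul_add] using hp.add hq
    | monomial l d =>
      refine (((hW.summable_pow_smul (k + l)).mul_left c).mul_right dᴴ).congr fun x => ?_
      simp [matEval_monomial, pow_add, smul_smul, mul_comm]

theorem innerW_add_right (hW : IsWeight W) (P Q R : Polynomial (Mat N)) :
    innerW W P (Q + R) = innerW W P Q + innerW W P R := by
  simp only [innerW, matEval_add, conjTranspose_add, mul_add]
  exact (hW.summable P Q).tsum_add (hW.summable P R)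

theorem innerW_C_mul_right (hW : IsWeight W) (M : Mat N) (P Q : Polynomial (Mat N)) :
    innerW W P (C M * Q) = innerW W P Q * Mᴴ := by
  simp only [innerW, matEval_C_mul, conjTranspose_mul, ← mul_assoc]
  exact (hW.summable P Q).tsum_mul_right _

theorem conjTranspose_innerW (hW : IsWeight W) (P Q : Polynomial (Mat N)) :
    (innerW W P Q)ᴴ = innerW W Q P := by
  rw [innerW, innerW, conjTranspose_tsum]
  simp [mul_assoc, hW.isHermitian]

theorem innerW_X_mul_right (P Q : Polynomial (Mat N)) :
    innerW W P (X * Q) = innerW W (X * P) Q := by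
  simp [innerW, matEval_X_mul]

theorem innerW_zero_right (P : Polynomial (Mat N)) : innerW W P 0 = 0 := by
  simp [innerW, matEval]

/-- Polynomials with vanishing quadratic form in a direction vanish in that direction. -/
theorem conjTranspose_matEval_mulVec_eq_zero (hW : IsWeight W) (P : Polynomial (Mat N))
    (v : Fin N → ℂ)
    (hv : innerW W P P *ᵥ v = 0) (x : ℕ) : (matEval P x)ᴴ *ᵥ v = 0 := by
  have hs : HasSum (fun x : ℕ => matEval P x * W x * (matEval P x)ᴴ) (innerW W P P) :=
    (hW.summable P P).hasSum
  let φ : Mat N →+ ℂ :=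
    { toFun := fun M => star v ⬝ᵥ (M *ᵥ v)
      map_zero' := by simp
      map_add' := fun M M' => by simp [add_mulVec] }
  have hφ : Continuous φ := by
    change Continuous fun M : Mat N => star v ⬝ᵥ (M *ᵥ v)
    fun_prop
  have h0 := hs.map φ hφ
  have h0' : φ (innerW W P P) = 0 := by
    change star v ⬝ᵥ (innerW W P P *ᵥ v) = 0
    rw [hv, dotProduct_zero]
  rw [h0'] at h0
  have hterm (y : ℕ) : (φ ∘ fun x : ℕ => matEval P x * W x * (matEval P x)ᴴ) y
      = star ((matEval P y)ᴴ *ᵥ v) ⬝ᵥ (W y *ᵥ ((matEval P y)ᴴ *ᵥ v)) := by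
    change star v ⬝ᵥ ((matEval P y * W y * (matEval P y)ᴴ) *ᵥ v) = _
    simp [star_mulVec, dotProduct_mulVec, vecMul_vecMul, ← mul_assoc]
  have hnn (y : ℕ) : 0 ≤ (φ ∘ fun x : ℕ => matEval P x * W x * (matEval P x)ᴴ) y := by
    rw [hterm]
    exact (hW.posDef y).posSemidef.dotProduct_mulVec_nonneg _
  have hz := congrFun ((hasSum_zero_iff_of_nonneg hnn).1 h0) x
  rw [hterm] at hz
  by_contra hne
  exact ((hW.posDef x).dotProduct_mulVec_pos hne).ne' hz

theorem isUnit_innerW_self (hW : IsWeight W) {P : Polynomial (Mat N)} (hP : P.Monic) :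
    IsUnit (innerW W P P) := by
  rw [isUnit_iff_isUnit_det, isUnit_iff_ne_zero]
  intro hdet
  obtain ⟨v, hv0, hv⟩ := exists_mulVec_eq_zero_iff.2 hdet
  refine hv0 (funext fun i => ?_)
  let q : ℂ[X] := ∑ k ∈ Finset.range (P.natDegree + 1),
    monomial k (((P.coeff k)ᴴ *ᵥ v) i)
  have hq (x : ℕ) : q.eval (x : ℂ) = 0 := by
    have h := congrFun (hW.conjTranspose_matEval_mulVec_eq_zero P v hv x) i
    rw [matEval, eval_eq_sum_range, conjTranspose_sum, sum_mulVec, Finset.sum_apply] at h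
    simpa [q, eval_finsetSum, _root_.smul_pow, smul_mulVec, mul_comm] using h
  have hq0 : q = 0 := by
    refine eq_zero_of_infinite_isRoot q ?_
    exact (Set.infinite_range_of_injective (Nat.cast_injective (R := ℂ))).mono
      (by rintro _ ⟨x, rfl⟩; exact hq x)
  have := congrArg (fun p : ℂ[X] => p.coeff P.natDegree) hq0
  simpa [q, coeff_monomial, hP.coeff_natDegree] using this

end IsWeight

namespace IsMOS

variable {N : ℕ} {W : ℤ → Mat N} {P : ℕ → Polynomial (Mat N)}

theorem coeff_self (hP : IsMOS W P) (n : ℕ) : (P n).coeff n = 1 := by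
  simpa [hP.deg n] using (hP.monic n).coeff_natDegree

theorem coeff_of_lt (hP : IsMOS W P) {n k : ℕ} (h : n < k) : (P n).coeff k = 0 :=
  coeff_eq_zero_of_natDegree_lt ((hP.deg n).trans_lt h)

theorem innerW_of_degree_lt (hP : IsMOS W P) (hW : IsWeight W) {n : ℕ} :
    ∀ {d : ℕ}, d ≤ n → ∀ {Q : Polynomial (Mat N)}, Q.degree < d → innerW W (P n) Q = 0
  | 0, _, Q, hQ => by
    have : Q = 0 := by simpa using hQ
    rw [this, IsWeight.innerW_zero_right]
  | d + 1, hd, Q, hQ => by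
    have hdeg : (Q - C (Q.coeff d) * P d).degree < d := by
      rw [degree_lt_iff_coeff_zero] at hQ ⊢
      intro k hk
      rcases hk.eq_or_lt with rfl | hk
      · simp [hP.coeff_self]
      · simp [hP.coeff_of_lt hk, hQ k hk]
    have h := hW.innerW_add_right (P n) (Q - C (Q.coeff d) * P d) (C (Q.coeff d) * P d)
    rw [sub_add_cancel, hW.innerW_C_mul_right, hP.orth n d (by omega), zero_mul, add_zero] at h
    rw [h]
    exact hP.innerW_of_degree_lt hW (by omega) hdeg

theorem innerW_of_natDegree_le (hP : IsMOS W P) (hW : IsWeight W) {n : ℕ}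
    {Q : Polynomial (Mat N)} (hQ : Q.natDegree ≤ n) :
    innerW W (P n) Q = innerW W (P n) (P n) * (Q.coeff n)ᴴ := by
  have hdeg : (Q - C (Q.coeff n) * P n).degree < n := by
    rw [degree_lt_iff_coeff_zero]
    intro k hk
    rcases hk.eq_or_lt with rfl | hk
    · simp [hP.coeff_self]
    · simp [hP.coeff_of_lt hk, coeff_eq_zero_of_natDegree_lt (hQ.trans_lt hk)]
  have h := hW.innerW_add_right (P n) (Q - C (Q.coeff n) * P n) (C (Q.coeff n) * P n)
  rwa [sub_add_cancel, hW.innerW_C_mul_right, hP.innerW_of_degree_lt hW le_rfl hdeg,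
    zero_add] at h

end IsMOS

/-- The translation `P ↦ P(x + 1) A` on matrix polynomials. -/
def shiftMul {N : ℕ} (A : Mat N) (P : Polynomial (Mat N)) : Polynomial (Mat N) :=
  taylor 1 P * C A

section Charlier

variable {N : ℕ} {a : ℝ} {A W0 : Mat N} {W : ℤ → Mat N}

theorem matEval_shiftMul (P : Polynomial (Mat N)) (z : ℂ) :
    matEval (shiftMul A P) z = matEval P (z + 1) * A := by
  rw [shiftMul, matEval_mul_C, ← matEval_taylor, one_smul]

theorem natDegree_shiftMul_le (P : Polynomial (Mat N)) :
    (shiftMul A P).natDegree ≤ P.natDegree :=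
  (natDegree_mul_C_le _ _).trans (natDegree_taylor P 1).le

theorem smul_weight_succ
    (hform : ∀ x : ℕ, W (x : ℤ)
      = ((a ^ x / x.factorial : ℝ) : ℂ) • (A ^ x * W0 * (Aᴴ) ^ x)) (x : ℕ) :
    ((x : ℂ) + 1) • W ((x + 1 : ℕ) : ℤ) = (a : ℂ) • (A * W x * Aᴴ) := by
  have hx : (x : ℂ) + 1 ≠ 0 := Nat.cast_add_one_ne_zero x
  have hx' : (x.factorial : ℂ) ≠ 0 := by exact_mod_cast x.factorial_ne_zero
  rw [hform, hform, pow_succ' A, pow_succ Aᴴ, mul_smul_comm, smul_mul_assoc, smul_smul, smul_smul]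
  congr 1
  · rw [Nat.factorial_succ]
    push_cast
    field_simp
    ring
  · simp only [mul_assoc]

theorem innerW_X_mul_left (hW : IsWeight W)
    (hform : ∀ x : ℕ, W (x : ℤ)
      = ((a ^ x / x.factorial : ℝ) : ℂ) • (A ^ x * W0 * (Aᴴ) ^ x))
    (P Q : Polynomial (Mat N)) :
    innerW W (X * P) Q = (a : ℂ) • innerW W (shiftMul A P) (shiftMul A Q) := by
  rw [innerW, (hW.summable (X * P) Q).tsum_eq_zero_add, innerW,
    ← (hW.summable (shiftMul A P) (shiftMul A Q)).tsum_const_smul]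
  simp only [matEval_X_mul, Nat.cast_zero, zero_smul, zero_mul, zero_add]
  refine tsum_congr fun x => ?_
  have h := smul_weight_succ hform x
  calc _ = matEval P (x + 1) * (((x : ℂ) + 1) • W ((x + 1 : ℕ) : ℤ)) * (matEval Q (x + 1))ᴴ := by
        simp
    _ = _ := by
        rw [h]
        simp [matEval_shiftMul, mul_assoc]

theorem innerW_shiftMul_left (hW : IsWeight W) (hA : IsUnit A)
    (hform : ∀ x : ℕ, W (x : ℤ)
      = ((a ^ x / x.factorial : ℝ) : ℂ) • (A ^ x * W0 * (Aᴴ) ^ x))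
    (P Q : Polynomial (Mat N)) :
    (a : ℂ) • innerW W (shiftMul A P) Q
      = innerW W P (X * (taylor (-1) Q * C A⁻¹)) := by
  rw [IsWeight.innerW_X_mul_right, innerW_X_mul_left hW hform]
  congr 1
  refine tsum_congr fun x => ?_
  have hdet := (isUnit_iff_isUnit_det A).1 hA
  have h : matEval (shiftMul A (taylor (-1) Q * C A⁻¹)) (x : ℂ) = matEval Q x := by
    have h1 : (-1 : Mat N) = (-1 : ℂ) • (1 : Mat N) := by simp
    rw [matEval_shiftMul, matEval_mul_C, h1, matEval_taylor, add_neg_cancel_right,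
      nonsing_inv_mul_cancel_right _ _ hdet]
  rw [h]

variable {P : ℕ → Polynomial (Mat N)}

theorem coeff_shiftMul_sub (hP : IsMOS W P) (n : ℕ) :
    (X * (shiftMul A (P n) - C A * P n)).coeff n
      = n * A + (X * P n).coeff n * A - A * (X * P n).coeff n := by
  cases n with
  | zero => simp
  | succ m =>
    have h := coeff_taylor_one_of_natDegree_le (hP.deg (m + 1)).le
    simp only [coeff_X_mul, coeff_sub, shiftMul, coeff_mul_C, coeff_C_mul, h, hP.coeff_self]
    push_cast
    noncomm_ring

theorem degree_shiftMul_sub_lt (hP : IsMOS W P) (n : ℕ) :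
    (shiftMul A (P n) - C A * P n).degree < n := by
  rw [degree_lt_iff_coeff_zero]
  intro k hk
  have h := coeff_taylor_of_natDegree_le 1 ((hP.deg n).trans_le hk)
  rcases hk.eq_or_lt with rfl | hk
  · simp [shiftMul, h, hP.coeff_self]
  · simp [shiftMul, h, hP.coeff_of_lt hk]

theorem innerW_shiftMul_of_degree_lt (hP : IsMOS W P) (hW : IsWeight W) (hA : IsUnit A)
    (hform : ∀ x : ℕ, W (x : ℤ)
      = ((a ^ x / x.factorial : ℝ) : ℂ) • (A ^ x * W0 * (Aᴴ) ^ x))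
    {n : ℕ} {Q : Polynomial (Mat N)} (hQ : Q.degree < n) :
    (a : ℂ) • innerW W (shiftMul A (P n)) Q
      = innerW W (P n) (P n) * (Aᴴ)⁻¹ * ((X * Q).coeff n)ᴴ := by
  rw [innerW_shiftMul_left hW hA hform]
  cases n with
  | zero =>
    have : Q = 0 := by simpa using hQ
    simp [this, IsWeight.innerW_zero_right]
  | succ m =>
    have hQm : Q.natDegree ≤ m := natDegree_le_of_degree_lt_succ hQ
    have hd : (X * (taylor (-1) Q * C A⁻¹)).natDegree ≤ m + 1 := by
      refine natDegree_mul_le.trans ?_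
      have := (natDegree_mul_C_le (taylor (-1) Q) A⁻¹).trans (natDegree_taylor Q (-1)).le
      have := natDegree_X_le (R := Mat N)
      omega
    rw [hP.innerW_of_natDegree_le hW hd, coeff_X_mul, coeff_X_mul, coeff_mul_C,
      coeff_taylor_of_natDegree_le _ hQm, conjTranspose_mul, conjTranspose_nonsing_inv, mul_assoc]

/-- Lowering relation between consecutive squared norms. -/
theorem lowering_norm (hP : IsMOS W P) (hW : IsWeight W) (hA : IsUnit A)
    (hform : ∀ x : ℕ, W (x : ℤ)
      = ((a ^ x / x.factorial : ℝ) : ℂ) • (A ^ x * W0 * (Aᴴ) ^ x)) (n : ℕ) :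
    (a : ℂ) • ((X * (shiftMul A (P (n + 1)) - C A * P (n + 1))).coeff (n + 1)
        * innerW W (P n) (P n))
      = innerW W (P (n + 1)) (P (n + 1)) * (Aᴴ)⁻¹ := by
  have hdeg := degree_shiftMul_sub_lt (A := A) hP (n + 1)
  have hle : (shiftMul A (P (n + 1)) - C A * P (n + 1)).natDegree ≤ n :=
    natDegree_le_of_degree_lt_succ hdeg
  have h1 := congrArg conjTranspose (hP.innerW_of_natDegree_le hW hle)
  rw [hW.conjTranspose_innerW, conjTranspose_mul, hW.conjTranspose_innerW,
    conjTranspose_conjTranspose] at h1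
  have h2 : innerW W (shiftMul A (P (n + 1))) (P n)
      = innerW W (shiftMul A (P (n + 1)) - C A * P (n + 1)) (P n) := by
    rw [← hW.conjTranspose_innerW (P n), ← hW.conjTranspose_innerW (P n)]
    have h := hW.innerW_add_right (P n) (shiftMul A (P (n + 1)) - C A * P (n + 1))
      (C A * P (n + 1))
    rw [sub_add_cancel, hW.innerW_C_mul_right, hP.orth n (n + 1) (by omega), zero_mul,
      add_zero] at h
    rw [h]
  have hPn : (P n).degree < ((n + 1 : ℕ) : WithBot ℕ) := by
    rw [degree_lt_iff_coeff_zero]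
    exact fun k hk => hP.coeff_of_lt hk
  rw [coeff_X_mul, ← h1, ← h2, innerW_shiftMul_of_degree_lt hP hW hA hform hPn]
  simp [hP.coeff_self]

/-- The diagonal three-term recurrence coefficient, multiplied by the squared norm. -/
theorem diagonal_coeff_mul_norm (hP : IsMOS W P) (hW : IsWeight W) (hA : IsUnit A)
    (hform : ∀ x : ℕ, W (x : ℤ)
      = ((a ^ x / x.factorial : ℝ) : ℂ) • (A ^ x * W0 * (Aᴴ) ^ x)) (n : ℕ) :
    ((X * P n).coeff n - (X * P (n + 1)).coeff (n + 1)) * innerW W (P n) (P n)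
      = (a : ℂ) • (A * innerW W (P n) (P n) * Aᴴ)
        + innerW W (P n) (P n) * (Aᴴ)⁻¹
          * ((X * (shiftMul A (P n) - C A * P n)).coeff n)ᴴ := by
  have hle : (X * P n - P (n + 1)).natDegree ≤ n := by
    rw [natDegree_le_iff_coeff_eq_zero]
    intro k hk
    obtain ⟨k, rfl⟩ : ∃ j, k = j + 1 := ⟨k - 1, by omega⟩
    rw [coeff_sub, coeff_X_mul]
    rcases (Nat.lt_succ_iff.1 hk).eq_or_lt with rfl | h
    · simp [hP.coeff_self]
    · simp [hP.coeff_of_lt h, hP.coeff_of_lt (Nat.succ_lt_succ h)]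
  have h1 : innerW W (X * P n) (P n)
      = ((X * P n).coeff n - (X * P (n + 1)).coeff (n + 1)) * innerW W (P n) (P n) := by
    have h := congrArg conjTranspose (hP.innerW_of_natDegree_le hW hle)
    rw [conjTranspose_mul, hW.conjTranspose_innerW (P n) (P n), conjTranspose_conjTranspose] at h
    have h' := hW.innerW_add_right (P n) (X * P n - P (n + 1)) (P (n + 1))
    rw [sub_add_cancel, hP.orth n (n + 1) (by omega), add_zero] at h'
    rw [← hW.conjTranspose_innerW, h', h, coeff_X_mul, coeff_sub]
  have h2 : innerW W (shiftMul A (P n)) (C A * P n) = A * innerW W (P n) (P n) * Aᴴ := by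
    have hs := hP.innerW_of_natDegree_le hW
      ((natDegree_shiftMul_le (A := A) (P n)).trans (hP.deg n).le)
    have hc : (shiftMul A (P n)).coeff n = A := by
      rw [shiftMul, coeff_mul_C, coeff_taylor_of_natDegree_le _ (hP.deg n).le, hP.coeff_self,
        one_mul]
    rw [hW.innerW_C_mul_right, ← hW.conjTranspose_innerW (P n), hs, hc, conjTranspose_mul,
      conjTranspose_conjTranspose, hW.conjTranspose_innerW]
  have h3 := innerW_shiftMul_of_degree_lt hP hW hA hform (degree_shiftMul_sub_lt (A := A) hP n)
  have h4 := hW.innerW_add_right (shiftMul A (P n)) (C A * P n) (shiftMul A (P n) - C A * P n)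
  rw [add_sub_cancel] at h4
  rw [← h1, innerW_X_mul_left hW hform, h4, smul_add, h2, h3]

/-- One step of the recurrence, with the inverse of the preceding norm absorbed in the
subleading coefficient of the lowering relation. -/
theorem norm_succ (hP : IsMOS W P) (hW : IsWeight W) (hA : IsUnit A)
    (hform : ∀ x : ℕ, W (x : ℤ)
      = ((a ^ x / x.factorial : ℝ) : ℂ) • (A ^ x * W0 * (Aᴴ) ^ x))
    {H : Mat N} {n : ℕ} (hH : H = innerW W (P n) (P n)) {B : Mat N}
    (hB : B = (X * (shiftMul A (P n) - C A * P n)).coeff n) :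
    innerW W (P (n + 1)) (P (n + 1))
      = ((a : ℂ) ^ 2) • (A ^ 2 * H * (Aᴴ) ^ 2)
        - ((a : ℂ) ^ 2) • (A * H * Aᴴ * H⁻¹ * A * H * Aᴴ)
        + (a : ℂ) • (A * H * Aᴴ)
        + (a : ℂ) • (B * H * Aᴴ + A * H * (Aᴴ)⁻¹ * Bᴴ * Aᴴ
            - H * (Aᴴ)⁻¹ * Bᴴ * H⁻¹ * A * H * Aᴴ) := by
  have hdetA : IsUnit (Aᴴ).det := by
    rw [det_conjTranspose]
    exact ((isUnit_iff_isUnit_det A).1 hA).star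
  have hdetH : IsUnit H.det := by
    rw [hH]
    exact (isUnit_iff_isUnit_det _).1 (hW.isUnit_innerW_self (hP.monic n))
  set b : Mat N := (X * P n).coeff n - (X * P (n + 1)).coeff (n + 1) with hb
  have hbH := diagonal_coeff_mul_norm hP hW hA hform n
  have hlow := lowering_norm hP hW hA hform n
  rw [← hb, ← hH, ← hB] at hbH
  have hstep : (X * (shiftMul A (P (n + 1)) - C A * P (n + 1))).coeff (n + 1)
      = B + A - b * A + A * b := by
    rw [hB, coeff_shiftMul_sub hP, coeff_shiftMul_sub hP, hb]
    push_cast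
    noncomm_ring
  have hbval : b = ((a : ℂ) • (A * H * Aᴴ) + H * (Aᴴ)⁻¹ * Bᴴ) * H⁻¹ := by
    rw [← hbH, mul_nonsing_inv_cancel_right _ _ hdetH]
  rw [hstep, ← hH] at hlow
  have hlow' := congrArg (· * Aᴴ) hlow
  simp only [nonsing_inv_mul_cancel_right _ _ hdetA] at hlow'
  rw [← hlow']
  have e : (B + A - b * A + A * b) * H = B * H + A * H - b * A * H
      + A * ((a : ℂ) • (A * H * Aᴴ) + H * (Aᴴ)⁻¹ * Bᴴ) := by
    rw [← hbH]
    noncomm_ring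
  rw [e, hbval]
  simp only [add_mul, sub_mul, mul_add, smul_mul_assoc, mul_smul_comm, smul_add, smul_sub,
    smul_smul, pow_two, mul_assoc]
  abel

end Charlier

/-- the nonlinear recurrence for the squared norms of the monic
orthogonal polynomials of the manifestly symmetric Charlier-type weight. -/
theorem norm_nonlinear_recurrence {N : ℕ} (a : ℝ) (ha : 0 < a)
    (A W0 : Mat N) (hA : IsUnit A) (hW0 : W0.PosDef)
    (W : ℤ → Mat N) (hW : IsWeight W)
    (hform : ∀ x : ℕ, W (x : ℤ)
      = ((a ^ x / x.factorial : ℝ) : ℂ) • (A ^ x * W0 * (Aᴴ) ^ x))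
    (P : ℕ → Polynomial (Mat N)) (hP : IsMOS W P)
    (H : ℕ → Mat N) (hH : ∀ n, H n = innerW W (P n) (P n)) :
    (∀ n : ℕ, 2 ≤ n →
      H n = ((a : ℂ) ^ 2) • (A ^ 2 * H (n - 1) * (Aᴴ) ^ 2)
          - ((a : ℂ) ^ 2) • (A * H (n - 1) * Aᴴ * (H (n - 1))⁻¹ * A * H (n - 1) * Aᴴ)
          + (a : ℂ) • (A * H (n - 1) * Aᴴ)
          + A * H (n - 1) * (Aᴴ)⁻¹ * (H (n - 2))⁻¹ * A⁻¹ * H (n - 1) * Aᴴ) ∧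
    H 1 = ((a : ℂ) ^ 2) • (A ^ 2 * H 0 * (Aᴴ) ^ 2)
        - ((a : ℂ) ^ 2) • (A * H 0 * Aᴴ * (H 0)⁻¹ * A * H 0 * Aᴴ)
        + (a : ℂ) • (A * H 0 * Aᴴ) := by
  have hdetA : IsUnit A.det := (isUnit_iff_isUnit_det A).1 hA
  have hdetH (n : ℕ) : IsUnit (H n).det := by
    rw [hH]
    exact (isUnit_iff_isUnit_det _).1 (hW.isUnit_innerW_self (hP.monic n))
  have hherm (n : ℕ) : (H n)ᴴ = H n := by rw [hH, hW.conjTranspose_innerW]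
  constructor
  · intro n hn
    obtain ⟨m, rfl⟩ : ∃ m, n = m + 2 := ⟨n - 2, by omega⟩
    simp only [Nat.add_sub_cancel, show m + 2 - 1 = m + 1 by omega]
    have hlow := lowering_norm hP hW hA hform m
    rw [← hH, ← hH] at hlow
    set B := (X * (shiftMul A (P (m + 1)) - C A * P (m + 1))).coeff (m + 1) with hB
    have hBval : (a : ℂ) • B = H (m + 1) * (Aᴴ)⁻¹ * (H m)⁻¹ := by
      rw [← hlow, smul_mul_assoc, mul_nonsing_inv_cancel_right _ _ (hdetH m)]
    have hBstar : (a : ℂ) • Bᴴ = (H m)⁻¹ * A⁻¹ * H (m + 1) := by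
      have h := congrArg conjTranspose hBval
      simpa [conjTranspose_nonsing_inv, hherm, mul_assoc] using h
    rw [hH (m + 2), norm_succ hP hW hA hform (hH (m + 1)) hB]
    congr 1
    have e : (a : ℂ) • (B * H (m + 1) * Aᴴ + A * H (m + 1) * (Aᴴ)⁻¹ * Bᴴ * Aᴴ
            - H (m + 1) * (Aᴴ)⁻¹ * Bᴴ * (H (m + 1))⁻¹ * A * H (m + 1) * Aᴴ)
        = ((a : ℂ) • B) * H (m + 1) * Aᴴ + A * H (m + 1) * (Aᴴ)⁻¹ * ((a : ℂ) • Bᴴ) * Aᴴ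
            - H (m + 1) * (Aᴴ)⁻¹ * ((a : ℂ) • Bᴴ) * (H (m + 1))⁻¹ * A * H (m + 1) * Aᴴ := by
      simp only [smul_mul_assoc, mul_smul_comm, smul_add, smul_sub]
    rw [e, hBval, hBstar]
    simp only [← mul_assoc, mul_nonsing_inv_cancel_right _ _ (hdetH (m + 1)),
      nonsing_inv_mul_cancel_right _ _ hdetA]
    abel
  · rw [hH 1, norm_succ hP hW hA hform (hH 0) rfl]
    simp
end
end
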